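/- arXiv:2506.16630 — 3 statements merged into one kernel-verified Lean document; each statement's English description precedes it below -/
import Mathlib

section
/- Let θ : U → V be a partial automorphism on a locally compact Hausdorff space X. Set Y = D_+ \ D_1. Then θ^n(Y ∩ D_{-n}) = D_+ ∩ (D_n \ D_{n+1}) for every n ≥ 0; consequently the sets θ^n(Y ∩ D_{-n}), n ≥ 0, are pairwise disjoint and their union equals D_+. -/
open Set MeasureTheory

namespace PartialAut

variable {X : Type*} [TopologicalSpace X]

/-- Domains reachable by applying `θ` forwards: `Dpos e n = D_n` (codomain of `θ^n`). -/
def Dpos (e : PartialHomeomorph X X) : ℕ → Set X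
  | 0 => Set.univ
  | n + 1 => ⇑e '' (Dpos e n ∩ e.source)

/-- `Dneg e n = D_{-n}`, the maximal domain of `θ^n`. -/
def Dneg (e : PartialHomeomorph X X) : ℕ → Set X
  | 0 => Set.univ
  | n + 1 => e.source ∩ ⇑e ⁻¹' (Dneg e n)

/-- `D e n = D_n` for `n : ℤ`. -/
def D (e : PartialHomeomorph X X) : ℤ → Set X
  | Int.ofNat n => Dpos e n
  | Int.negSucc n => Dneg e (n + 1)

/-- `iter e n = θ^n` (as an everywhere-defined function; only meaningful on `D e (-n)`). -/
def iter (e : PartialHomeomorph X X) : ℤ → X → X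
  | Int.ofNat n => (⇑e)^[n]
  | Int.negSucc n => (⇑e.symm)^[n + 1]

/-- The orbit of a point. -/
def orb (e : PartialHomeomorph X X) (x : X) : Set X :=
  {y | ∃ n : ℤ, x ∈ D e (-n) ∧ y = iter e n x}

/-- The forward orbit of a point. -/
def orbFwd (e : PartialHomeomorph X X) (x : X) : Set X :=
  {y | ∃ n : ℕ, x ∈ D e (-(n : ℤ)) ∧ y = (⇑e)^[n] x}

/-- The backward orbit of a point. -/
def orbBwd (e : PartialHomeomorph X X) (x : X) : Set X :=
  {y | ∃ n : ℕ, x ∈ D e (n : ℤ) ∧ y = (⇑e.symm)^[n] x}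

/-- `D_+`. -/
def Dplus (e : PartialHomeomorph X X) : Set X :=
  (⋂ n > (0 : ℤ), D e (-n)) \ ⋂ n : ℤ, D e n

/-- `D_-`. -/
def Dminus (e : PartialHomeomorph X X) : Set X :=
  (⋂ n > (0 : ℤ), D e n) \ ⋂ n : ℤ, D e n

/-- `D_gl`. -/
def Dgl (e : PartialHomeomorph X X) : Set X := ⋂ n : ℤ, D e n

/-- `D_fin`. -/
def Dfin (e : PartialHomeomorph X X) : Set X :=
  Set.univ \ (Dplus e ∪ Dminus e ∪ Dgl e)

/-- A `θ`-invariant subset. -/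
def Invariant (e : PartialHomeomorph X X) (Y : Set X) : Prop :=
  ⇑e '' (Y ∩ e.source) ⊆ Y ∧ ⇑e.symm '' (Y ∩ e.target) ⊆ Y

/-- Minimality of a partial automorphism. -/
def Minimal (e : PartialHomeomorph X X) : Prop :=
  ∀ Y : Set X, IsClosed Y → Invariant e Y → Y = ∅ ∨ Y = Set.univ

/-- A `θ`-invariant measure: `μ(θ⁻¹(Z)) = μ(Z)` for measurable `Z ⊆ V`. -/
def InvariantMeasure [MeasurableSpace X] (e : PartialHomeomorph X X)
    (μ : Measure X) : Prop :=
  ∀ Z : Set X, MeasurableSet Z → Z ⊆ e.target → μ (⇑e.symm '' Z) = μ Z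

/-- A `d`-conformal measure: `μ(θ(Z)) = d·μ(Z)` for measurable `Z ⊆ U`. -/
def Conformal [MeasurableSpace X] (e : PartialHomeomorph X X) (d : ℕ)
    (μ : Measure X) : Prop :=
  ∀ Z : Set X, MeasurableSet Z → Z ⊆ e.source → μ (⇑e '' Z) = (d : ENNReal) * μ Z

/-- Invariance of a measure under the restricted partial automorphism `θ^{(W)}`
(for `W ⊆ U`): `μ(σ⁻¹(Z)) = μ(Z)` for every measurable `Z ⊆ θ(W)`. -/
def RestrInvariant [MeasurableSpace X] (e : PartialHomeomorph X X) (W : Set X)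
    (μ : Measure X) : Prop :=
  ∀ Z : Set X, MeasurableSet Z → Z ⊆ ⇑e '' (W ∩ e.source) →
    μ (⇑e.symm '' Z) = μ Z

/-- `Y` meets every `θ`-orbit at most once. -/
def MeetsOrbitAtMostOnce (e : PartialHomeomorph X X) (Y : Set X) : Prop :=
  ∀ n : ℤ, n ≠ 0 → ∀ y ∈ Y ∩ D e (-n), iter e n y ∈ Y → iter e n y = y

/-- A point has a periodic orbit if it lies in `D_gl` and has finite orbit. -/
def Periodic (e : PartialHomeomorph X X) (x : X) : Prop :=
  x ∈ Dgl e ∧ (orb e x).Finite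

/-- The set `X^{(l)}` of points of `D_gl` whose orbit has exactly `l` elements. -/
def Xl (e : PartialHomeomorph X X) (l : ℕ) : Set X :=
  {x ∈ Dgl e | (orb e x).Finite ∧ (orb e x).ncard = l}

/-- The relation generating the orbit equivalence relation. -/
def orbitRel (e : PartialHomeomorph X X) (x y : X) : Prop :=
  x ∈ e.source ∧ y = e x

/-- The orbit setoid. -/
def orbitSetoid (e : PartialHomeomorph X X) : Setoid X :=
  Relation.EqvGen.setoid (orbitRel e)

/-- The orbit space `X/ℤ` with the quotient topology. -/
abbrev OrbitSpace (e : PartialHomeomorph X X) : Type _ :=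
  Quotient (orbitSetoid e)

/-- The quotient map onto the orbit space. -/
def pr (e : PartialHomeomorph X X) : X → OrbitSpace e :=
  Quotient.mk (orbitSetoid e)

end PartialAut

namespace PartialAut

section Helpers

variable {X : Type*} [TopologicalSpace X]

/-! ### Helper lemmas -/

theorem mem_Dplus (e : PartialHomeomorph X X) (x : X) :
    x ∈ Dplus e ↔ (∀ n : ℕ, x ∈ Dneg e n) ∧ ∃ n : ℕ, x ∉ Dpos e n := by
  have hneg : x ∈ (⋂ n > (0 : ℤ), D e (-n)) ↔ ∀ n : ℕ, x ∈ Dneg e n := by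
    simp only [mem_iInter]
    constructor
    · intro h n
      cases n with
      | zero => exact mem_univ x
      | succ k => exact h ((k : ℤ) + 1) (by positivity)
    · intro h n hn
      obtain ⟨k, rfl⟩ : ∃ k : ℕ, n = (k : ℤ) + 1 := ⟨(n - 1).toNat, by omega⟩
      exact h (k + 1)
  have hall : (∀ n : ℕ, x ∈ Dneg e n) → (x ∈ (⋂ n : ℤ, D e n) ↔ ∀ n : ℕ, x ∈ Dpos e n) := by
    intro hx
    simp only [mem_iInter]
    constructor
    · intro h n
      exact h (n : ℤ)
    · intro h n
      cases n with
      | ofNat k => exact h k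
      | negSucc k => exact hx (k + 1)
  unfold Dplus
  rw [mem_diff, hneg]
  constructor
  · rintro ⟨h1, h2⟩
    rw [hall h1] at h2
    exact ⟨h1, not_forall.mp h2⟩
  · rintro ⟨h1, h2⟩
    refine ⟨h1, ?_⟩
    rw [hall h1]
    exact not_forall.mpr h2

theorem injOn_source (e : PartialHomeomorph X X) : Set.InjOn (⇑e) e.source :=
  e.toPartialEquiv.injOn

theorem apply_mem_Dpos_succ (e : PartialHomeomorph X X) {x : X} (hx : x ∈ e.source) (n : ℕ) :
    e x ∈ Dpos e (n + 1) ↔ x ∈ Dpos e n := by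
  constructor
  · rintro ⟨y, ⟨hy, hys⟩, hyx⟩
    rwa [← injOn_source e hys hx hyx]
  · intro h
    exact ⟨x, ⟨h, hx⟩, rfl⟩

theorem Dpos_antitone (e : PartialHomeomorph X X) : Antitone (Dpos e) := by
  apply antitone_nat_of_succ_le
  intro n
  induction n with
  | zero => exact subset_univ _
  | succ k ih => exact image_mono (inter_subset_inter_left _ ih)

theorem mem_source_of_Dplus (e : PartialHomeomorph X X) {x : X} (hx : x ∈ Dplus e) :
    x ∈ e.source :=
  (((mem_Dplus e x).1 hx).1 1).1

theorem apply_mem_Dplus (e : PartialHomeomorph X X) {x : X} (hx : x ∈ e.source) :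
    e x ∈ Dplus e ↔ x ∈ Dplus e := by
  rw [mem_Dplus, mem_Dplus]
  constructor
  · rintro ⟨h, n, hn⟩
    refine ⟨fun k => ?_, ?_⟩
    · cases k with
      | zero => exact mem_univ x
      | succ k => exact ⟨hx, h k⟩
    · cases n with
      | zero => exact absurd (mem_univ _) hn
      | succ k => exact ⟨k, fun hk => hn ((apply_mem_Dpos_succ e hx k).2 hk)⟩
  · rintro ⟨h, n, hn⟩
    exact ⟨fun k => (h (k + 1)).2, n + 1, fun hk => hn ((apply_mem_Dpos_succ e hx n).1 hk)⟩

theorem image_layer (e : PartialHomeomorph X X) (n : ℕ) :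
    (⇑e)^[n] '' (Dplus e \ Dpos e 1) = Dplus e ∩ (Dpos e n \ Dpos e (n + 1)) := by
  induction n with
  | zero =>
    ext x
    simp [Dpos]
  | succ k ih =>
    rw [Function.iterate_succ', image_comp, ih]
    ext y
    constructor
    · rintro ⟨x, ⟨hx, h1, h2⟩, rfl⟩
      have hs := mem_source_of_Dplus e hx
      exact ⟨(apply_mem_Dplus e hs).2 hx, (apply_mem_Dpos_succ e hs k).2 h1,
        fun h => h2 ((apply_mem_Dpos_succ e hs (k + 1)).1 h)⟩
    · rintro ⟨hy, ⟨x, ⟨hx, hs⟩, rfl⟩, h2⟩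
      exact ⟨x, ⟨(apply_mem_Dplus e hs).1 hy, hx,
        fun h => h2 ((apply_mem_Dpos_succ e hs (k + 1)).2 h)⟩, rfl⟩

theorem inter_Dneg (e : PartialHomeomorph X X) (n : ℕ) :
    (Dplus e \ D e 1) ∩ D e (-(n : ℤ)) = Dplus e \ Dpos e 1 := by
  apply Set.inter_eq_left.2
  rintro x ⟨hx, -⟩
  cases n with
  | zero => exact mem_univ x
  | succ k => exact ((mem_Dplus e x).1 hx).1 (k + 1)

theorem layers_disjoint (e : PartialHomeomorph X X) {m n : ℕ} (h : m < n) :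
    Disjoint (Dplus e ∩ (Dpos e m \ Dpos e (m + 1))) (Dplus e ∩ (Dpos e n \ Dpos e (n + 1))) := by
  rw [Set.disjoint_left]
  rintro x ⟨-, -, h1⟩ ⟨-, h2, -⟩
  exact h1 (Dpos_antitone e h h2)

end Helpers

theorem statement1 {X : Type*} [TopologicalSpace X] [LocallyCompactSpace X] [T2Space X]
    (e : PartialHomeomorph X X) :
    (∀ n : ℕ, (⇑e)^[n] '' ((Dplus e \ D e 1) ∩ D e (-(n : ℤ))) =
      Dplus e ∩ (D e (n : ℤ) \ D e ((n : ℤ) + 1))) ∧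
    (∀ m n : ℕ, m ≠ n →
      Disjoint ((⇑e)^[m] '' ((Dplus e \ D e 1) ∩ D e (-(m : ℤ))))
        ((⇑e)^[n] '' ((Dplus e \ D e 1) ∩ D e (-(n : ℤ))))) ∧
    (⋃ n : ℕ, (⇑e)^[n] '' ((Dplus e \ D e 1) ∩ D e (-(n : ℤ)))) = Dplus e := by
  simp only [inter_Dneg, image_layer]
  refine ⟨fun n => rfl, ?_, ?_⟩
  · intro m n hmn
    rcases lt_or_gt_of_ne hmn with h | h
    · exact layers_disjoint e h
    · exact (layers_disjoint e h).symm
  · ext x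
    simp only [mem_iUnion]
    constructor
    · rintro ⟨n, hx, -⟩
      exact hx
    · intro hx
      by_contra hcon
      obtain ⟨n, hn⟩ := ((mem_Dplus e x).1 hx).2
      apply hn
      clear hn
      induction n with
      | zero => exact mem_univ x
      | succ k ih =>
        by_contra hk
        exact hcon ⟨k, hx, ih, hk⟩

end PartialAut
end

section
/- Let θ : U → V be a partial automorphism on a compact Hausdorff space X and let d > 1 be a natural number. If D_- or D_fin is nonempty, then there exists a regular Borel probability measure on X that is d-conformal with respect to θ. -/
open Set MeasureTheory

namespace PartialAut


theorem exists_not_source {X : Type*} [TopologicalSpace X] (e : PartialHomeomorph X X)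
    (h : (Dminus e).Nonempty ∨ (Dfin e).Nonempty) : ∃ y, y ∉ e.source := by
  by_contra! hc
  have hneg : ∀ n x, x ∈ Dneg e n := by
    intro n
    induction n with
    | zero => intro x; trivial
    | succ n ih => intro x; exact ⟨hc x, ih _⟩
  have hm : ∀ x, ∀ n > (0 : ℤ), x ∈ D e (-n) := by
    intro x n hn
    obtain ⟨k, rfl⟩ : ∃ k : ℕ, n = k + 1 := ⟨(n - 1).toNat, by omega⟩
    have : -((k : ℤ) + 1) = Int.negSucc k := by rw [Int.negSucc_eq]
    rw [this]
    exact hneg (k + 1) x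
  rcases h with ⟨x, hx, hx'⟩ | ⟨x, -, hx⟩
  · apply hx'
    simp only [mem_iInter] at hx ⊢
    intro n
    cases n with
    | ofNat n =>
      cases n with
      | zero => trivial
      | succ n => exact hx _ (by simp)
    | negSucc n => exact hneg (n + 1) x
  · apply hx
    by_cases hg : x ∈ Dgl e
    · exact Or.inr hg
    · refine Or.inl (Or.inl ⟨?_, hg⟩)
      simp only [mem_iInter]
      exact hm x

theorem dirac_innerRegular {X : Type*} [TopologicalSpace X] [T2Space X]
    [MeasurableSpace X] [BorelSpace X] (x : X) : (Measure.dirac x).InnerRegular := by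
  constructor
  intro s hs r hr
  by_cases hx : x ∈ s
  · refine ⟨{x}, by simpa using hx, isCompact_singleton, ?_⟩
    rw [Measure.dirac_apply_of_mem hx] at hr
    rw [Measure.dirac_apply_of_mem (by simp)]
    exact hr
  · simp [Measure.dirac_apply, hx] at hr

theorem statement9 {X : Type*} [TopologicalSpace X] [CompactSpace X] [T2Space X]
    [MeasurableSpace X] [BorelSpace X]
    (e : PartialHomeomorph X X) (d : ℕ) (hd : 1 < d)
    (h : (Dminus e).Nonempty ∨ (Dfin e).Nonempty) :
    ∃ μ : Measure X, IsProbabilityMeasure μ ∧ μ.Regular ∧ Conformal e d μ := by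
  classical
  obtain ⟨y, hy⟩ := exists_not_source e h
  let p : ℕ → X := fun k => (⇑e.symm)^[k] y
  have hp : ∀ k, p (k + 1) = e.symm (p k) := fun k => Function.iterate_succ_apply' _ _ _
  let A : ℕ → Prop := fun k => ∀ j < k, p j ∈ e.target
  let a : ℕ → ENNReal := fun k => if A k then ((d : ENNReal)⁻¹) ^ k else 0
  have hd0 : (d : ENNReal) ≠ 0 := by
    simp; omega
  have hdt : (d : ENNReal) ≠ ⊤ := ENNReal.natCast_ne_top d
  let ν : Measure X := Measure.sum fun k => a k • Measure.dirac (p k)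
  have hν : ∀ s, ν s = ∑' k, a k * s.indicator 1 (p k) := by
    intro s
    simp only [ν]
    rw [Measure.sum_apply_of_countable]
    simp [Measure.dirac_apply]
  have hconf : Conformal e d ν := by
    intro Z _ hZ
    rw [hν, hν Z, tsum_eq_zero_add' (f := fun k => a k * Z.indicator 1 (p k)) ENNReal.summable]
    have h0 : p 0 ∉ Z := fun hz => hy (hZ hz)
    rw [indicator_of_notMem h0, mul_zero, zero_add, ← ENNReal.tsum_mul_left]
    congr 1
    ext k
    by_cases hk : A k ∧ p k ∈ ⇑e '' Z
    · obtain ⟨hA, z, hz, hzk⟩ := hk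
      have hzs := hZ hz
      have ht : p k ∈ e.target := hzk ▸ e.map_source hzs
      have hA' : A (k + 1) := by
        intro j hj
        rcases Nat.lt_succ_iff_lt_or_eq.mp hj with hj | rfl
        · exact hA j hj
        · exact ht
      have hpz : p (k + 1) = z := by
        rw [hp, ← hzk]; exact e.left_inv hzs
      have h1 : p k ∈ ⇑e '' Z := ⟨z, hz, hzk⟩
      have h2 : p (k + 1) ∈ Z := hpz ▸ hz
      simp only [a, hA, hA', if_true, indicator_of_mem h1, indicator_of_mem h2, Pi.one_apply,
        mul_one]
      rw [pow_succ', ← mul_assoc, ENNReal.mul_inv_cancel hd0 hdt, one_mul]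
    · have hk' : ¬ (A (k + 1) ∧ p (k + 1) ∈ Z) := by
        rintro ⟨hA, hz⟩
        refine hk ⟨fun j hj => hA j (by omega), p (k + 1), hz, ?_⟩
        rw [hp]
        exact e.right_inv (hA k (by omega))
      have e1 : a k * (⇑e '' Z).indicator 1 (p k) = 0 := by
        by_cases hA : A k
        · rw [indicator_of_notMem (fun hz => hk ⟨hA, hz⟩), mul_zero]
        · simp [a, hA]
      have e2 : a (k + 1) * Z.indicator 1 (p (k + 1)) = 0 := by
        by_cases hA : A (k + 1)
        · rw [indicator_of_notMem (fun hz => hk' ⟨hA, hz⟩), mul_zero]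
        · simp [a, hA]
      rw [e1, e2, mul_zero]
  have hu : ν univ = ∑' k, a k := by
    rw [hν]; simp
  have hne : ν univ ≠ 0 := by
    rw [hu]
    intro h0
    have := ENNReal.tsum_eq_zero.mp h0 0
    simp [a, A] at this
  have hfin : ν univ ≠ ⊤ := by
    rw [hu]
    have hle : ∑' k, a k ≤ ∑' k : ℕ, ((d : ENNReal)⁻¹) ^ k := by
      apply ENNReal.tsum_le_tsum
      intro k
      simp only [a]
      split_ifs
      · exact le_rfl
      · exact zero_le
    refine ne_top_of_le_ne_top ?_ hle
    rw [ENNReal.tsum_geometric]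
    apply ENNReal.inv_ne_top.mpr
    have : (d : ENNReal)⁻¹ < 1 := ENNReal.inv_lt_one.mpr (by exact_mod_cast hd)
    exact (tsub_pos_of_lt this).ne'
  have hir : ∀ x : X, (Measure.dirac x).InnerRegular := dirac_innerRegular
  have hνr : ν.InnerRegular := by
    simp only [ν]; infer_instance
  have hprob : IsProbabilityMeasure ((ν univ)⁻¹ • ν) :=
    ⟨by simp [ENNReal.inv_mul_cancel hne hfin]⟩
  refine ⟨(ν univ)⁻¹ • ν, hprob, inferInstance, ?_⟩
  intro Z hm hZ
  simp only [Measure.smul_apply, smul_eq_mul]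
  rw [hconf Z hm hZ, mul_left_comm]

end PartialAut
end

section
/- Let θ : U → V be a partial automorphism on a locally compact Hausdorff space X, let Y ⊆ D_gl be a set that meets every θ-orbit at most once, and let L be a measurable subset of Y such that no point of L has a periodic orbit. Then μ(L) = 0 and μ(θ(L)) = 0 for every regular Borel probability measure μ on X that is θ^{(U\Y)}-invariant. -/
open Set MeasureTheory

namespace PartialAut

open Topology Filter in
theorem aux_lift {A B : Type*} [TopologicalSpace A] [CompactSpace A] [T2Space A]
    [MeasurableSpace A] [BorelSpace A] [TopologicalSpace B] [CompactSpace B] [T2Space B]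
    [MeasurableSpace B] [BorelSpace B] (p : C(A, B)) (μ : Measure B) [IsFiniteMeasure μ]
    [μ.Regular] (hr : μ (range p)ᶜ = 0) :
    ∃ ν : Measure A, IsFiniteMeasure ν ∧ ν.Regular ∧ ν.map p = μ := by
  have hint : ∀ g : C(B, ℝ), Integrable g μ := fun g =>
    g.continuous.integrable_of_hasCompactSupport (HasCompactSupport.of_compactSpace g)
  let I : C(B, ℝ) →ₗ[ℝ] ℝ :=
    { toFun := fun g => ∫ x, g x ∂μ
      map_add' := fun g h => integral_add (hint g) (hint h)
      map_smul' := fun c g => integral_const_mul c _ }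
  let Φ : C(B, ℝ) →ₗ[ℝ] C(A, ℝ) :=
    { toFun := fun g => g.comp p
      map_add' := fun g h => rfl
      map_smul' := fun c g => rfl }
  have hpos : ∀ g : C(B, ℝ), (∀ a, 0 ≤ g (p a)) → 0 ≤ I g := by
    intro g hg
    refine integral_nonneg_of_ae ?_
    have : ∀ᵐ x ∂μ, x ∈ range p := hr
    filter_upwards [this] with x hx
    obtain ⟨a, rfl⟩ := hx
    exact hg a
  have hker : LinearMap.ker Φ ≤ LinearMap.ker I := by
    intro g hg
    have h0 : ∀ a, g (p a) = 0 := fun a => DFunLike.congr_fun (LinearMap.mem_ker.1 hg) a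
    have h1 := hpos g (fun a => (h0 a).ge)
    have h2 := hpos (-g) (fun a => by simp [h0 a])
    rw [map_neg] at h2
    exact LinearMap.mem_ker.2 (by linarith)
  let F : C(A, ℝ) →ₗ.[ℝ] ℝ :=
    { domain := LinearMap.range Φ
      toFun := (Submodule.liftQ (LinearMap.ker Φ) I hker) ∘ₗ
        Φ.quotKerEquivRange.symm.toLinearMap }
  have hF : ∀ (g : C(B, ℝ)) (h : Φ g ∈ LinearMap.range Φ), F ⟨Φ g, h⟩ = I g := by
    intro g h
    change (Submodule.liftQ (LinearMap.ker Φ) I hker) (Φ.quotKerEquivRange.symm ⟨Φ g, h⟩) = I g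
    rw [LinearMap.quotKerEquivRange_symm_apply_image]
    simp
  let s : PointedCone ℝ C(A, ℝ) :=
    { carrier := {f | ∀ a, 0 ≤ f a}
      add_mem' := fun {f g} hf hg a => add_nonneg (hf a) (hg a)
      zero_mem' := fun a => le_rfl
      smul_mem' := fun c f hf a => mul_nonneg c.2 (hf a) }
  obtain ⟨G, hG, hGs⟩ := riesz_extension s F
    (by
      rintro ⟨x, g, rfl⟩ hx
      exact (hpos g hx).trans_eq (hF g ⟨g, rfl⟩).symm)
    (by
      intro y
      refine ⟨⟨Φ (ContinuousMap.const B ‖y‖), ⟨_, rfl⟩⟩, ?_⟩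
      intro a
      have := (abs_le.1 (y.norm_coe_le_norm a)).1
      change 0 ≤ ‖y‖ + y a
      linarith)
  let Λ : CompactlySupportedContinuousMap A ℝ →ₚ[ℝ] ℝ :=
    PositiveLinearMap.mk₀
      { toFun := fun f => G f.toContinuousMap
        map_add' := fun f g => G.map_add _ _
        map_smul' := fun c g => G.map_smul _ _ }
      (fun f hf => hGs _ (fun a => hf a))
  refine ⟨RealRMK.rieszMeasure Λ, ?_, inferInstance, ?_⟩
  · infer_instance
  · have : IsFiniteMeasure (RealRMK.rieszMeasure Λ) := inferInstance
    have i1 := Measure.InnerRegularCompactLTTop.map_of_continuous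
      (μ := RealRMK.rieszMeasure Λ) p.continuous
    have : ((RealRMK.rieszMeasure Λ).map p).Regular := inferInstance
    refine Measure.ext_of_integral_eq_on_compactlySupported fun f => ?_
    refine (integral_map p.continuous.aemeasurable
      f.continuous.measurable.aestronglyMeasurable).trans ?_
    have h1 := RealRMK.integral_rieszMeasure Λ
      ⟨Φ f.toContinuousMap, HasCompactSupport.of_compactSpace _⟩
    refine h1.trans ?_
    change G (Φ f.toContinuousMap) = I f.toContinuousMap
    exact (hG ⟨Φ f.toContinuousMap, ⟨_, rfl⟩⟩).trans (hF _ ⟨_, rfl⟩)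

theorem aux_null {A B : Type*} [TopologicalSpace A] [CompactSpace A] [T2Space A]
    [MeasurableSpace A] [BorelSpace A] [TopologicalSpace B] [T2Space B]
    [MeasurableSpace B] [BorelSpace B] (p : C(A, B)) (ν : Measure A) [IsFiniteMeasure ν]
    [ν.Regular] (S : Set B) (hS : MeasurableSet (p ⁻¹' S))
    (hC : ∀ C ⊆ S, IsCompact C → ν.map p C = 0) : ν.map p S = 0 := by
  have h0 : ν (p ⁻¹' S) = 0 := by
    by_contra hne
    obtain ⟨C, hCS, hCc, hpos⟩ := hS.exists_lt_isCompact (pos_iff_ne_zero.2 hne)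
    have h1 := hC (p '' C) (image_subset_iff.2 hCS) (hCc.image p.continuous)
    rw [Measure.map_apply p.continuous.measurable
      (hCc.image p.continuous).measurableSet] at h1
    exact hpos.ne' (measure_mono_null (subset_preimage_image p C) h1)
  refine le_antisymm (le_of_forall_gt fun ε hε => ?_) zero_le
  obtain ⟨W, hW, hWo, hWε⟩ := (p ⁻¹' S).exists_isOpen_lt_of_lt (μ := ν) ε (by rwa [h0])
  have hF : IsCompact (p '' Wᶜ) := hWo.isClosed_compl.isCompact.image p.continuous
  calc ν.map p S ≤ ν.map p (p '' Wᶜ)ᶜ := by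
        refine measure_mono ?_
        rintro x hx ⟨a, ha, rfl⟩
        exact ha (hW hx)
    _ = ν (p ⁻¹' (p '' Wᶜ)ᶜ) :=
        Measure.map_apply p.continuous.measurable hF.measurableSet.compl
    _ ≤ ν W := by
        refine measure_mono fun a ha => ?_
        by_contra h
        exact ha ⟨a, h, rfl⟩
    _ < ε := hWε

open Topology Filter in
theorem aux_graph {E K : Type*} [TopologicalSpace E] [TopologicalSpace K] [T2Space K]
    (i j : E → K) (hi : IsEmbedding i) (hj : Continuous j) {a b : K}
    (h : (a, b) ∈ closure (range fun z => (i z, j z))) (ha : a ∈ range i) : b ∈ range j := by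
  obtain ⟨z, rfl⟩ := ha
  have hne : NeBot (comap (fun z => (i z, j z)) (𝓝 (i z, b))) := by
    rw [comap_neBot_iff_frequently]
    exact mem_closure_iff_frequently.1 h
  have ht : Tendsto (fun z => (i z, j z)) (comap (fun z => (i z, j z)) (𝓝 (i z, b)))
    (𝓝 (i z, b)) := tendsto_comap
  have h1 := (continuous_fst.tendsto _).comp ht
  have h2 := (continuous_snd.tendsto _).comp ht
  have h3 : Tendsto id (comap (fun z => (i z, j z)) (𝓝 (i z, b))) (𝓝 z) :=
    hi.tendsto_nhds_iff.2 h1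
  have h4 := (hj.tendsto z).comp h3
  exact ⟨z, tendsto_nhds_unique h4 h2⟩

open Topology Filter in
theorem aux_embed_compact {E K : Type*} [TopologicalSpace E] [TopologicalSpace K] [CompactSpace K]
    [T2Space K] [MeasurableSpace K] [BorelSpace K]
    (i j : E → K) (hi : IsEmbedding i) (hj : IsEmbedding j) (hm : MeasurableSet (range i))
    (μ : Measure K) [IsFiniteMeasure μ] [μ.Regular]
    (hC : ∀ C ⊆ range j, IsCompact C → μ C = 0) : μ (range j) = 0 := by
  let Γ : Set (K × K) := closure (range fun z => (i z, j z))
  have hΓ : IsCompact Γ := isClosed_closure.isCompact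
  have : CompactSpace Γ := isCompact_iff_compactSpace.1 hΓ
  let mΓ : MeasurableSpace Γ := borel Γ
  have bΓ : BorelSpace Γ := ⟨rfl⟩
  let p : C(Γ, K) := ⟨fun x => x.1.2, by fun_prop⟩
  let q : C(Γ, K) := ⟨fun x => x.1.1, by fun_prop⟩
  have hT : IsCompact (range p) := isCompact_range p.continuous
  have hjT : range j ⊆ range p := by
    rintro _ ⟨z, rfl⟩
    exact ⟨⟨(i z, j z), subset_closure ⟨z, rfl⟩⟩, rfl⟩
  have : (μ.restrict (range p)).Regular :=
    Measure.Regular.restrict_of_measure_ne_top (measure_ne_top _ _)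
  obtain ⟨ν, hν1, hν2, hν⟩ := aux_lift p (μ.restrict (range p))
    (by rw [Measure.restrict_apply hT.measurableSet.compl]; simp)
  have hpre : p ⁻¹' (range j) = q ⁻¹' (range i) := by
    ext ⟨⟨a, b⟩, hab⟩
    constructor
    · intro h
      refine aux_graph j i hj hi.continuous (a := b) ?_ h
      have := map_mem_closure (continuous_swap (X := K) (Y := K)) hab
        (t := range fun z => (j z, i z)) (by rintro _ ⟨z, rfl⟩; exact ⟨z, rfl⟩)
      exact this
    · intro h
      exact aux_graph i j hi hj.continuous hab h
  have key := aux_null p ν (range j)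
    (by rw [hpre]; exact q.continuous.measurable hm)
    (by
      intro C hCj hCc
      rw [hν]
      exact le_antisymm ((Measure.restrict_apply_le _ _).trans (hC C hCj hCc).le) zero_le)
  rw [hν, Measure.restrict_eq_self _ hjT] at key
  exact key

open Topology Filter in
theorem aux_embed {E X : Type*} [TopologicalSpace E] [TopologicalSpace X] [LocallyCompactSpace X]
    [T2Space X] [MeasurableSpace X] [BorelSpace X]
    (i j : E → X) (hi : IsEmbedding i) (hj : IsEmbedding j) (hm : MeasurableSet (range i))
    (μ : Measure X) [IsFiniteMeasure μ] [μ.Regular]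
    (hC : ∀ C ⊆ range j, IsCompact C → μ C = 0) : μ (range j) = 0 := by
  let mK : MeasurableSpace (OnePoint X) := borel _
  have bK : BorelSpace (OnePoint X) := ⟨rfl⟩
  let c : X → OnePoint X := (↑)
  have hc : IsOpenEmbedding c := OnePoint.isOpenEmbedding_coe
  have hme := hc.measurableEmbedding
  have i1 : (μ.map c).InnerRegularCompactLTTop :=
    Measure.InnerRegularCompactLTTop.map_of_continuous hc.continuous
  have i2 : (μ.map c).Regular := inferInstance
  have := aux_embed_compact (c ∘ i) (c ∘ j) (hc.isEmbedding.comp hi) (hc.isEmbedding.comp hj)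
    (by rw [range_comp]; exact hme.measurableSet_image.2 hm) (μ.map c)
    (by
      intro C hCj hCc
      rw [hme.map_apply]
      refine hC _ ?_ ?_
      · intro x hx
        obtain ⟨z, hz⟩ := hCj hx
        exact ⟨z, hc.injective hz⟩
      · refine hc.isInducing.isCompact_preimage' hCc ?_
        intro x hx
        obtain ⟨z, rfl⟩ := hCj hx
        exact ⟨_, rfl⟩)
  rwa [hme.map_apply, range_comp, preimage_image_eq _ hc.injective] at this

theorem aux_wander {X : Type*} [TopologicalSpace X] [T2Space X] [MeasurableSpace X] [BorelSpace X]
    (μ : Measure X) [IsFiniteMeasure μ] (f : X → X) (S K : Set X) (hf : ContinuousOn f S)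
    (hinj : InjOn f S) (hK : IsCompact K) (hS : ∀ n : ℕ, ∀ x ∈ K, f^[n] x ∈ S)
    (hret : ∀ n : ℕ, ∀ x ∈ K, f^[n + 1] x ∉ K)
    (hinv : ∀ n : ℕ, IsCompact (f^[n] '' K) → IsCompact (f^[n + 1] '' K) →
      μ (f^[n + 1] '' K) = μ (f^[n] '' K)) : μ K = 0 := by
  have hcomp : ∀ n : ℕ, IsCompact (f^[n] '' K) := by
    intro n
    induction n with
    | zero => simpa using hK
    | succ n ih =>
      rw [Function.iterate_succ', image_comp]
      refine ih.image_of_continuousOn (hf.mono ?_)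
      rintro _ ⟨x, hx, rfl⟩
      exact hS n x hx
  have hconst : ∀ n : ℕ, μ (f^[n] '' K) = μ K := by
    intro n
    induction n with
    | zero => simp
    | succ n ih => rw [hinv n (hcomp n) (hcomp _), ih]
  have hne : ∀ n k : ℕ, ∀ x ∈ K, ∀ y ∈ K, f^[n] x ≠ f^[n + (k + 1)] y := by
    intro n k
    induction n with
    | zero =>
      intro x hx y hy h
      rw [zero_add] at h
      exact hret k y hy (h ▸ hx)
    | succ n ih =>
      intro x hx y hy h
      rw [show n + 1 + (k + 1) = (n + (k + 1)) + 1 by ring, Function.iterate_succ_apply',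
        Function.iterate_succ_apply'] at h
      exact ih x hx y hy (hinj (hS _ x hx) (hS _ y hy) h)
  have hdis : Pairwise (Function.onFun Disjoint fun n : ℕ => f^[n] '' K) := by
    have key : ∀ m n : ℕ, m < n → Disjoint (f^[m] '' K) (f^[n] '' K) := by
      intro m n hmn
      obtain ⟨k, rfl⟩ := Nat.exists_eq_add_of_lt hmn
      rw [Set.disjoint_left]
      rintro _ ⟨x, hx, rfl⟩ ⟨y, hy, h⟩
      exact hne m k x hx y hy h.symm
    intro m n hmn
    rcases lt_or_gt_of_ne hmn with h | h
    · exact key m n h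
    · exact (key n m h).symm
  by_contra h0
  have h1 := measure_iUnion (μ := μ) hdis (fun n => (hcomp n).measurableSet)
  simp only [hconst] at h1
  rw [ENNReal.tsum_const_eq_top_of_ne_zero h0] at h1
  exact measure_ne_top μ _ h1

theorem aux_src {X : Type*} [TopologicalSpace X] (e : PartialHomeomorph X X) (n : ℕ) :
    ∀ x ∈ Dneg e (n + 1), (⇑e)^[n] x ∈ e.source := by
  induction n with
  | zero => intro x hx; exact hx.1
  | succ n ih => intro x hx; exact ih (e x) hx.2

theorem aux_tgt {X : Type*} [TopologicalSpace X] (e : PartialHomeomorph X X) (n : ℕ) :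
    ∀ x ∈ Dpos e (n + 1), (⇑e.symm)^[n] x ∈ e.target := by
  induction n with
  | zero =>
    rintro _ ⟨y, hy, rfl⟩
    exact e.map_source hy.2
  | succ n ih =>
    rintro _ ⟨y, hy, rfl⟩
    have h := ih y hy.1
    rw [Function.iterate_succ_apply, e.left_inv hy.2]
    exact h

theorem aux_left {X : Type*} (f g : X → X) (S : Set X) (hg : ∀ x ∈ S, g (f x) = x) (x : X)
    (hS : ∀ n : ℕ, f^[n] x ∈ S) (n : ℕ) : g^[n] (f^[n] x) = x := by
  induction n with
  | zero => rfl
  | succ n ih =>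
    rw [Function.iterate_succ_apply, Function.iterate_succ_apply', hg _ (hS n), ih]

theorem aux_orb {X : Type*} [TopologicalSpace X] (e : PartialHomeomorph X X) (x : X) (n : ℕ)
    (h1 : (⇑e)^[n + 1] x = x) (h2 : (⇑e.symm)^[n + 1] x = x) : (orb e x).Finite := by
  have hfin : ((fun k => (⇑e)^[k] x) '' Iio (n + 1) ∪
      (fun k => (⇑e.symm)^[k] x) '' Iio (n + 1)).Finite :=
    ((finite_Iio _).image _).union ((finite_Iio _).image _)
  refine hfin.subset ?_
  rintro y ⟨m, -, rfl⟩
  cases m with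
  | ofNat m =>
    left
    exact ⟨m % (n + 1), Nat.mod_lt _ n.succ_pos, Function.IsPeriodicPt.iterate_mod_apply h1 m⟩
  | negSucc m =>
    right
    exact ⟨(m + 1) % (n + 1), Nat.mod_lt _ n.succ_pos,
      Function.IsPeriodicPt.iterate_mod_apply h2 (m + 1)⟩

theorem statement15 {X : Type*} [TopologicalSpace X] [LocallyCompactSpace X] [T2Space X]
    [MeasurableSpace X] [BorelSpace X]
    (e : PartialHomeomorph X X) (Y : Set X) (hYgl : Y ⊆ Dgl e)
    (hY : MeetsOrbitAtMostOnce e Y)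
    (L : Set X) (hLm : MeasurableSet L) (hL : L ⊆ Y)
    (hper : ∀ x ∈ L, ¬ Periodic e x)
    (μ : Measure X) [IsProbabilityMeasure μ] [μ.Regular]
    (hμ : RestrInvariant e (e.source \ Y) μ) :
    μ L = 0 ∧ μ (⇑e '' L) = 0 := by
  have hs : ∀ x ∈ L, ∀ n : ℕ, (⇑e)^[n] x ∈ e.source := fun x hx n =>
    aux_src e n x (mem_iInter.1 (hYgl (hL hx)) (Int.negSucc n))
  have ht : ∀ x ∈ L, ∀ n : ℕ, (⇑e.symm)^[n] x ∈ e.target := fun x hx n =>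
    aux_tgt e n x (mem_iInter.1 (hYgl (hL hx)) (Int.ofNat (n + 1)))
  have hl : ∀ x ∈ L, ∀ n : ℕ, (⇑e.symm)^[n] ((⇑e)^[n] x) = x := fun x hx n =>
    aux_left e e.symm e.source (fun y hy => e.left_inv hy) x (hs x hx) n
  have hr : ∀ x ∈ L, ∀ n : ℕ, (⇑e)^[n] ((⇑e.symm)^[n] x) = x := fun x hx n =>
    aux_left e.symm e e.target (fun y hy => e.right_inv hy) x (ht x hx) n
  have hf : ∀ x ∈ L, ∀ n : ℕ, (⇑e)^[n + 1] x ∉ Y := by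
    intro x hx n hn
    have h1 : (⇑e)^[n + 1] x = x := hY (Int.ofNat (n + 1)) (by simp; omega) x
      ⟨hL hx, mem_iInter.1 (hYgl (hL hx)) _⟩ hn
    have h2 := hl x hx (n + 1)
    rw [h1] at h2
    exact hper x hx ⟨hYgl (hL hx), aux_orb e x n h1 h2⟩
  have hb : ∀ x ∈ L, ∀ n : ℕ, (⇑e.symm)^[n + 1] x ∉ Y := by
    intro x hx n hn
    have h1 : (⇑e.symm)^[n + 1] x = x := hY (Int.negSucc n) (by simp) x
      ⟨hL hx, mem_iInter.1 (hYgl (hL hx)) _⟩ hn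
    have h2 := hr x hx (n + 1)
    rw [h1] at h2
    exact hper x hx ⟨hYgl (hL hx), aux_orb e x n h2 h1⟩
  constructor
  · by_contra h0
    obtain ⟨K, hKL, hK, hpos⟩ := hLm.exists_lt_isCompact (pos_iff_ne_zero.2 h0)
    refine hpos.ne' (aux_wander μ e.symm e.target K e.continuousOn_symm e.symm.injOn hK
      (fun n x hx => ht x (hKL hx) n) (fun n x hx h => hb x (hKL hx) n (hL (hKL h))) ?_)
    intro n hc _
    rw [Function.iterate_succ', image_comp]
    refine hμ _ hc.measurableSet ?_
    rintro _ ⟨x, hx, rfl⟩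
    have h1 := ht x (hKL hx) n
    have h2 := hb x (hKL hx) n
    rw [Function.iterate_succ_apply'] at h2
    exact ⟨_, ⟨⟨e.map_target h1, h2⟩, e.map_target h1⟩, e.right_inv h1⟩
  · have hLs : L ⊆ e.source := fun x hx => hs x hx 0
    have hrange : range (fun z : L => e z) = ⇑e '' L := (image_eq_range e L).symm
    rw [← hrange]
    refine aux_embed (fun z : L => (z : X)) (fun z : L => e z) Topology.IsEmbedding.subtypeVal
      (e.isEmbedding_restrict.comp (Topology.IsEmbedding.inclusion hLs)) (by simpa using hLm) μ ?_
    rw [hrange]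
    intro C hCL hC
    have hsC : ∀ n : ℕ, ∀ c ∈ C, (⇑e)^[n] c ∈ e.source := by
      intro n c hc
      obtain ⟨x, hx, rfl⟩ := hCL hc
      exact hs x hx (n + 1)
    refine aux_wander μ e e.source C e.continuousOn e.injOn hC hsC ?_ ?_
    · intro n c hc h
      obtain ⟨x, hx, rfl⟩ := hCL hc
      obtain ⟨y, hy, hxy⟩ := hCL h
      rw [← Function.iterate_succ_apply, Function.iterate_succ_apply'] at hxy
      have := e.injOn (hLs hy) (hs x hx (n + 1)) hxy
      exact hf x hx n (this ▸ hL hy)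
    · intro n _ hc
      rw [← hμ _ hc.measurableSet]
      · congr 1
        rw [Function.iterate_succ', image_comp]
        refine LeftInvOn.image_image (s := (⇑e)^[n] '' C) ?_
        rintro _ ⟨c, hc, rfl⟩
        exact e.left_inv (hsC n c hc)
      · rintro _ ⟨c, hc, rfl⟩
        refine ⟨(⇑e)^[n] c, ⟨⟨hsC n c hc, ?_⟩, hsC n c hc⟩,
          (Function.iterate_succ_apply' _ _ _).symm⟩
        obtain ⟨x, hx, rfl⟩ := hCL hc
        exact hf x hx n

end PartialAut
end
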